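/- arXiv:math/0212126 — 2 statements merged into one kernel-verified Lean document; each statement's English description precedes it below -/
import Mathlib

section
/- Let t ∈ Y_n and let ω be the admissible shuffle with first block {r+1, r+2, …, r+k} (1 ≤ k ≤ n−1). Then p_ω(M(t)) = 0 if and only if t can be obtained from some tree u ∈ Y_{n−k} by grafting a tree s ∈ Y_k onto the leaf of u labeled r (so that s occupies exactly the leaves r, r+1, …, r+k of t and the internal vertices r+1, …, r+k of t); if t is not of this form, then p_ω(M(t)) > 0. -/
/-- Planar binary trees: a tree is either a single leaf, or the grafting
`node l r = l ∨ r` of two planar binary trees. `Y n` is the set of such trees with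
`n + 1` leaves. -/
inductive PBT : Type
  | leaf : PBT
  | node : PBT → PBT → PBT
  deriving DecidableEq

namespace PBT

/-- Number of leaves of a planar binary tree. A tree of `Y n` has `n + 1` leaves. -/
def leaves : PBT → ℕ
  | leaf => 1
  | node l r => l.leaves + r.leaves

/-- The list of coordinates of Loday's point `M(t)`: `M(|)` is the empty tuple and
`M(t^l ∨ t^r) = (M(t^l), p·q, M(t^r))` where `p`, `q` are the numbers of leaves of
`t^l`, `t^r`.  The `i`-th entry is the weight `a_i · b_i` of the `i`-th internal
vertex of `t`.  A tree `t` belongs to `Y n` iff `t.coords.length = n`. -/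
noncomputable def coords : PBT → List ℝ
  | leaf => []
  | node l r => l.coords ++ ((l.leaves : ℝ) * (r.leaves : ℝ)) :: r.coords

/-- The point `M(t) = (a_1 b_1, …, a_n b_n) ∈ ℝ^n`, for `t ∈ Y n`
(coordinates indexed by `Fin n`, the `i`-th coordinate being `x_{i+1}`). -/
noncomputable def M (n : ℕ) (t : PBT) : Fin n → ℝ := fun i => t.coords.getD i 0

end PBT

/-- The affine function `p_ω` associated to the shuffle `ω` whose first block is
`A` and second block is `Aᶜ` (0-indexed: `A ⊆ Fin n` corresponds to
`{ω_1,…,ω_k} ⊆ {1,…,n}`): with `k = |A|`,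
`p_ω(x) = (n−k)·(x_{ω_1}+⋯+x_{ω_k}) − k·(x_{ω_{k+1}}+⋯+x_{ω_n}) + n·k·(n−k)/2`. -/
noncomputable def pShuffle (n : ℕ) (A : Finset (Fin n)) (x : Fin n → ℝ) : ℝ :=
  ((n : ℝ) - A.card) * ∑ i ∈ A, x i - (A.card : ℝ) * ∑ i ∈ Aᶜ, x i
    + (n : ℝ) * A.card * ((n : ℝ) - A.card) / 2

namespace PBT

/-- `graft u i s` replaces the leaf of `u` labeled `i` (leaves being labeled
`0, 1, …` from left to right) by the tree `s`. -/
def graft : PBT → ℕ → PBT → PBT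
  | leaf, _, s => s
  | node l r, i, s =>
      if i < l.leaves then node (graft l i s) r else node l (graft r (i - l.leaves) s)

end PBT

namespace PBT

/-- The sum of the `k` consecutive coordinates of `M(t)` following the first `r` ones. -/
noncomputable def windowSum (t : PBT) (r k : ℕ) : ℝ := ((t.coords.drop r).take k).sum

theorem leaves_eq (t : PBT) : t.leaves = t.coords.length + 1 := by
  induction t with
  | leaf => rfl
  | node l r ihl ihr => simp only [leaves, coords, List.length_append, List.length_cons]; omega

theorem length_coords_node (l r : PBT) :
    (node l r).coords.length = l.coords.length + r.coords.length + 1 := by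
  simp only [coords, List.length_append, List.length_cons]; omega

theorem sum_coords (t : PBT) :
    t.coords.sum = (t.coords.length : ℝ) * (t.coords.length + 1) / 2 := by
  induction t with
  | leaf => simp [coords]
  | node l r ihl ihr =>
    rw [length_coords_node]
    simp only [coords, List.sum_append, List.sum_cons, ihl, ihr, leaves_eq]
    push_cast
    ring

theorem windowSum_node_left {l r : PBT} {i k : ℕ} (h : i + k ≤ l.coords.length) :
    (node l r).windowSum i k = l.windowSum i k := by
  rw [windowSum, windowSum, coords, List.drop_append_of_le_length (by omega),
    List.take_append_of_le_length (by rw [List.length_drop]; omega)]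

theorem windowSum_node_right {l r : PBT} {i k : ℕ} (h : l.leaves ≤ i) :
    (node l r).windowSum i k = r.windowSum (i - l.leaves) k := by
  rw [leaves_eq] at h ⊢
  obtain ⟨j, rfl⟩ := Nat.exists_eq_add_of_le h
  have : l.coords.length + 1 + j = l.coords.length + (j + 1) := by omega
  rw [windowSum, windowSum, coords, Nat.add_sub_cancel_left, this, List.drop_length_add_append,
    List.drop_succ_cons]

theorem windowSum_node_root {l r : PBT} {i a b : ℕ} (h : i + a = l.coords.length) :
    (node l r).windowSum i (a + b + 1) =
      l.windowSum i a + (l.coords.length + 1 : ℝ) * (r.coords.length + 1) + r.windowSum 0 b := by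
  have hlen : (l.coords.drop i).length = a := by rw [List.length_drop]; omega
  have htake : (l.coords.drop i).take a = l.coords.drop i := List.take_of_length_le hlen.le
  rw [windowSum, windowSum, windowSum, coords, List.drop_append_of_le_length (by omega), htake,
    show a + b + 1 = (l.coords.drop i).length + (b + 1) by omega, List.take_length_add_append,
    List.take_succ_cons, List.sum_append, List.sum_cons, List.drop_zero, leaves_eq, leaves_eq]
  push_cast
  ring

theorem le_windowSum (t : PBT) {i k : ℕ} (h : i + k ≤ t.coords.length) :
    (k : ℝ) * (k + 1) / 2 ≤ t.windowSum i k := by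
  induction t generalizing i k with
  | leaf =>
    obtain rfl : k = 0 := by simp only [coords, List.length_nil] at h; omega
    simp [windowSum]
  | node l r ihl ihr =>
    rw [length_coords_node] at h
    rcases le_or_gt (i + k) l.coords.length with hl | hl
    · rw [windowSum_node_left hl]; exact ihl hl
    rcases le_or_gt l.leaves i with hr | hr
    · rw [windowSum_node_right hr]
      rw [leaves_eq] at hr ⊢
      exact ihr (by omega)
    · rw [leaves_eq] at hr
      obtain ⟨a, ha⟩ := Nat.exists_eq_add_of_le (Nat.le_of_lt_succ hr)
      obtain ⟨b, rfl⟩ : ∃ b, k = a + b + 1 := ⟨k - a - 1, by omega⟩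
      rw [windowSum_node_root ha.symm]
      have h₁ := ihl ha.ge
      have h₂ := ihr (i := 0) (k := b) (by omega)
      have hap : (a : ℝ) ≤ l.coords.length := by exact_mod_cast (by omega)
      have hbq : (b : ℝ) ≤ r.coords.length := by exact_mod_cast (by omega)
      have h₃ : ((a : ℝ) + 1) * (b + 1) ≤ (l.coords.length + 1) * (r.coords.length + 1) := by
        gcongr
      push_cast
      linarith

theorem exists_eq_graft_of_windowSum_eq (t : PBT) {i k : ℕ} (hk : 0 < k)
    (h : i + k ≤ t.coords.length) (hs : t.windowSum i k = (k : ℝ) * (k + 1) / 2) :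
    ∃ u s : PBT, u.coords.length + k = t.coords.length ∧ s.coords.length = k ∧
      t = graft u i s := by
  induction t generalizing i k with
  | leaf => simp only [coords, List.length_nil] at h; omega
  | node l r ihl ihr =>
    rw [length_coords_node] at h ⊢
    rcases le_or_gt (i + k) l.coords.length with hl | hl
    · rw [windowSum_node_left hl] at hs
      obtain ⟨u, s, hu, hsk, rfl⟩ := ihl hk hl hs
      by_cases hi : i < u.leaves
      · refine ⟨node u r, s, ?_, hsk, by simp [graft, hi]⟩
        rw [length_coords_node]; omega
      · rw [leaves_eq] at hi; omega
    rcases le_or_gt l.leaves i with hr | hr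
    · rw [windowSum_node_right hr] at hs
      have hle : i - l.leaves + k ≤ r.coords.length := by rw [leaves_eq] at hr ⊢; omega
      obtain ⟨u, s, hu, hsk, hg⟩ := ihr hk hle hs
      refine ⟨node l u, s, ?_, hsk, by rw [graft, if_neg hr.not_gt, ← hg]⟩
      rw [length_coords_node]; omega
    · rw [leaves_eq] at hr
      obtain ⟨a, ha⟩ := Nat.exists_eq_add_of_le (Nat.le_of_lt_succ hr)
      obtain ⟨b, rfl⟩ : ∃ b, k = a + b + 1 := ⟨k - a - 1, by omega⟩
      rw [windowSum_node_root ha.symm] at hs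
      have h₁ := le_windowSum l ha.ge
      have h₂ := le_windowSum r (i := 0) (k := b) (by omega)
      push_cast at hs
      have h₃ : ((l.coords.length + 1) * (r.coords.length + 1) : ℝ) ≤ (a + 1) * (b + 1) := by
        linarith
      have h₄ : (l.coords.length + 1) * (r.coords.length + 1) ≤ (a + 1) * (b + 1) := by
        exact_mod_cast h₃
      have hi : i = 0 := by
        by_contra hi
        have hap : a + 1 < l.coords.length + 1 := by omega
        have hbq : b + 1 ≤ r.coords.length + 1 := by omega
        exact h₄.not_gt (Nat.mul_lt_mul_of_lt_of_le hap hbq (by omega))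
      have hb : b = r.coords.length := by
        by_contra hb
        have hap : a + 1 ≤ l.coords.length + 1 := by omega
        have hbq : b + 1 < r.coords.length + 1 := by omega
        exact h₄.not_gt (Nat.mul_lt_mul_of_le_of_lt hap hbq (by omega))
      refine ⟨leaf, node l r, ?_, ?_, rfl⟩
      · simp only [coords, List.length_nil]; omega
      · rw [length_coords_node]; omega

theorem exists_coords_graft (u s : PBT) {i : ℕ} (hi : i ≤ u.coords.length) :
    ∃ P Q : List ℝ, P.length = i ∧ (graft u i s).coords = P ++ (s.coords ++ Q) := by
  induction u generalizing i with
  | leaf =>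
    simp only [coords, List.length_nil] at hi
    exact ⟨[], [], by simp; omega, by simp [graft]⟩
  | node l r ihl ihr =>
    rw [length_coords_node] at hi
    by_cases h : i < l.leaves
    · rw [graft, if_pos h]
      rw [leaves_eq] at h
      obtain ⟨P, Q, hP, hc⟩ := ihl (Nat.le_of_lt_succ h)
      exact ⟨P, _, hP, by rw [coords, hc, List.append_assoc, List.append_assoc]⟩
    · rw [graft, if_neg h]
      rw [leaves_eq] at h ⊢
      obtain ⟨P, Q, hP, hc⟩ := ihr (i := i - (l.coords.length + 1)) (by omega)
      refine ⟨l.coords ++ _ :: P, Q, ?_, by rw [coords, hc, List.append_assoc, List.cons_append]⟩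
      rw [List.length_append, List.length_cons]; omega

theorem windowSum_graft (u s : PBT) {i : ℕ} (hi : i ≤ u.coords.length) :
    (graft u i s).windowSum i s.coords.length =
      (s.coords.length : ℝ) * (s.coords.length + 1) / 2 := by
  obtain ⟨P, Q, rfl, hc⟩ := exists_coords_graft u s hi
  rw [windowSum, hc, List.drop_left, List.take_left, sum_coords]

end PBT

theorem List.sum_range_getD_add (L : List ℝ) (r k : ℕ) :
    ∑ j ∈ Finset.range k, L.getD (r + j) 0 = ((L.drop r).take k).sum := by
  induction k with
  | zero => simp
  | succ k ih =>
    rw [Finset.sum_range_succ, ih, List.take_add_one, List.sum_append, List.getElem?_drop,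
      List.getD_eq_getElem?_getD]
    cases L[r + k]? <;> simp

theorem Fin.sum_filter_interval {n r k : ℕ} (h : r + k ≤ n) (f : ℕ → ℝ) :
    ∑ i ∈ Finset.univ.filter (fun i : Fin n => r ≤ (i : ℕ) ∧ (i : ℕ) < r + k), f i =
      ∑ j ∈ Finset.range k, f (r + j) := by
  rw [Finset.sum_filter,
    Fin.sum_univ_eq_sum_range (fun i => if r ≤ i ∧ i < r + k then f i else 0) n,
    ← Finset.sum_filter]
  have : (Finset.range n).filter (fun i => r ≤ i ∧ i < r + k) = Finset.Ico r (r + k) := by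
    ext i; simp only [Finset.mem_filter, Finset.mem_range, Finset.mem_Ico]; omega
  rw [this, Finset.sum_Ico_eq_sum_range, Nat.add_sub_cancel_left]

theorem pShuffle_M_interval {n r k : ℕ} (h : r + k ≤ n) {t : PBT} (ht : t.coords.length = n) :
    pShuffle n (Finset.univ.filter fun i : Fin n => r ≤ (i : ℕ) ∧ (i : ℕ) < r + k) (PBT.M n t) =
      n * (t.windowSum r k - (k : ℝ) * (k + 1) / 2) := by
  set A := Finset.univ.filter fun i : Fin n => r ≤ (i : ℕ) ∧ (i : ℕ) < r + k with hA
  have hcard : (A.card : ℝ) = k := by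
    have := Fin.sum_filter_interval h (fun _ => 1)
    simpa [← hA] using this
  have hsum : ∑ i ∈ A, PBT.M n t i = t.windowSum r k :=
    (Fin.sum_filter_interval h (fun i => t.coords.getD i 0)).trans
      (t.coords.sum_range_getD_add r k)
  have htotal : ∑ i, PBT.M n t i = (n : ℝ) * (n + 1) / 2 := by
    have h₁ := Fin.sum_univ_eq_sum_range (fun i => t.coords.getD i 0) n
    have h₂ := t.coords.sum_range_getD_add 0 n
    simp only [Nat.zero_add, List.drop_zero, List.take_of_length_le ht.le, PBT.sum_coords, ht]
      at h₂
    exact h₁.trans h₂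
  have hcompl : ∑ i ∈ Aᶜ, PBT.M n t i = (n : ℝ) * (n + 1) / 2 - t.windowSum r k := by
    rw [← htotal, ← hsum, ← Finset.sum_add_sum_compl A]; ring
  rw [pShuffle, hcard, hsum, hcompl]
  ring

/-- Let `t ∈ Y n` and let `ω` be the admissible shuffle with first block
`{r+1, …, r+k}` (`1 ≤ k ≤ n−1`).  Then `p_ω(M(t)) = 0` if and only if `t` is obtained
from some tree `u ∈ Y (n−k)` by grafting a tree `s ∈ Y k` onto the leaf of `u` labeled
`r`; if `t` is not of this form, then `p_ω(M(t)) > 0`. -/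
theorem stmt2 (n r k : ℕ) (hk : 0 < k) (hkn : k < n) (hrk : r + k ≤ n)
    (t : PBT) (ht : t.coords.length = n)
    (A : Finset (Fin n))
    (hA : A = Finset.univ.filter fun i : Fin n => r ≤ (i : ℕ) ∧ (i : ℕ) < r + k) :
    (pShuffle n A (PBT.M n t) = 0 ↔
      ∃ u s : PBT, u.coords.length = n - k ∧ s.coords.length = k ∧ t = PBT.graft u r s) ∧
    (¬ (∃ u s : PBT, u.coords.length = n - k ∧ s.coords.length = k ∧ t = PBT.graft u r s) →
      0 < pShuffle n A (PBT.M n t)) := by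
  subst hA
  rw [pShuffle_M_interval hrk ht]
  have hn : (0 : ℝ) < n := by exact_mod_cast hk.trans hkn
  have hiff : (n : ℝ) * (t.windowSum r k - (k : ℝ) * (k + 1) / 2) = 0 ↔
      ∃ u s : PBT, u.coords.length = n - k ∧ s.coords.length = k ∧ t = PBT.graft u r s := by
    rw [mul_eq_zero_iff_left hn.ne', sub_eq_zero]
    constructor
    · intro hs
      obtain ⟨u, s, hu, hsk, hg⟩ := t.exists_eq_graft_of_windowSum_eq hk (hrk.trans ht.ge) hs
      exact ⟨u, s, by omega, hsk, hg⟩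
    · rintro ⟨u, s, hu, rfl, rfl⟩
      exact u.windowSum_graft s (by omega)
  refine ⟨hiff, fun hne => lt_of_le_of_ne ?_ fun h => hne (hiff.1 h.symm)⟩
  exact mul_nonneg hn.le (sub_nonneg.2 (t.le_windowSum (hrk.trans ht.ge)))
end

section
/- Let N = (1, 2, …, n) and S = (n, n−1, …, 1) in ℝ^n. If t, t' ∈ Y_n are related by a covering relation of the Tamari order (t' obtained from t by replacing some subtree (u ∨ v) ∨ w by u ∨ (v ∨ w)), then ⟨M(t') − M(t), S − N⟩ > 0; that is, the orthogonal projection of the vertices onto the oriented axis from N to S strictly respects the Tamari order on covering relations. -/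
/-- The covering relation of the Tamari order, recording the numbers of leaves `p` of
`u` and `r` of `w`: somewhere inside the tree, a subtree of the form `(u ∨ v) ∨ w` is
replaced by `u ∨ (v ∨ w)`. -/
inductive TamariCovAt : ℕ → ℕ → PBT → PBT → Prop
  | rot (u v w : PBT) :
      TamariCovAt u.leaves w.leaves (PBT.node (PBT.node u v) w) (PBT.node u (PBT.node v w))
  | left {p r : ℕ} {l l' : PBT} (s : PBT) :
      TamariCovAt p r l l' → TamariCovAt p r (PBT.node l s) (PBT.node l' s)
  | right (s : PBT) {p r : ℕ} {t t' : PBT} :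
      TamariCovAt p r t t' → TamariCovAt p r (PBT.node s t) (PBT.node s t')

theorem PBT.leaves_pos (t : PBT) : 0 < t.leaves := by
  induction t with
  | leaf => simp [PBT.leaves]
  | node l r ihl ihr => simp only [PBT.leaves]; omega

/-- A covering relation preserves the number of leaves. -/
theorem TamariCovAt.leaves_eq {p r : ℕ} {t t' : PBT} (h : TamariCovAt p r t t') :
    t'.leaves = t.leaves := by
  induction h with
  | rot u v w => simp only [PBT.leaves]; omega
  | left s _ ih => simp only [PBT.leaves, ih]
  | right s _ ih => simp only [PBT.leaves, ih]

/-- A covering relation moves a positive quantity from one coordinate to an earlier one and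
fixes all other coordinates. -/
theorem TamariCovAt.exists_coords_eq {p r : ℕ} {t t' : PBT} (h : TamariCovAt p r t t') :
    ∃ (l₁ l₂ l₃ : List ℝ) (x y c : ℝ), 0 < c ∧
      t.coords = l₁ ++ x :: (l₂ ++ y :: l₃) ∧
      t'.coords = l₁ ++ (x + c) :: (l₂ ++ (y - c) :: l₃) := by
  induction h with
  | rot u v w =>
    refine ⟨u.coords, v.coords, w.coords, u.leaves * v.leaves,
      (u.leaves + v.leaves) * w.leaves, u.leaves * w.leaves, ?_, ?_, ?_⟩
    · have := u.leaves_pos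
      have := w.leaves_pos
      positivity
    · simp [PBT.coords, PBT.leaves]
    · simp [PBT.coords, PBT.leaves, mul_add, add_mul]
  | left s h ih =>
    obtain ⟨l₁, l₂, l₃, x, y, c, hc, h₁, h₂⟩ := ih
    exact ⟨l₁, l₂, l₃ ++ _ :: s.coords, x, y, c, hc, by simp [PBT.coords, h₁]; rfl,
      by simp [PBT.coords, h₂, h.leaves_eq]⟩
  | right s h ih =>
    obtain ⟨l₁, l₂, l₃, x, y, c, hc, h₁, h₂⟩ := ih
    exact ⟨s.coords ++ _ :: l₁, l₂, l₃, x, y, c, hc, by simp [PBT.coords, h₁]; rfl,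
      by simp [PBT.coords, h₂, h.leaves_eq]⟩

theorem List.getD_sub_getD_of_transfer (l₁ l₂ l₃ : List ℝ) (x y c : ℝ) (k : ℕ) :
    (l₁ ++ (x + c) :: (l₂ ++ (y - c) :: l₃)).getD k 0 -
        (l₁ ++ x :: (l₂ ++ y :: l₃)).getD k 0 =
      (if k = l₁.length then c else 0) - if k = l₁.length + 1 + l₂.length then c else 0 := by
  simp only [List.getD_eq_getElem?_getD, List.getElem?_append, List.getElem?_cons]
  grind

/-- Let `N = (1, 2, …, n)` and `S = (n, n−1, …, 1)` in `ℝ^n`.  If `t, t' ∈ Y n` are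
related by a covering relation of the Tamari order (`t'` obtained from `t` by replacing
some subtree `(u ∨ v) ∨ w` by `u ∨ (v ∨ w)`), then `⟨M(t') − M(t), S − N⟩ > 0`: the
orthogonal projection of the vertices onto the oriented axis from `N` to `S` strictly
respects the Tamari order on covering relations. -/
theorem stmt13 (n p r : ℕ) (t t' : PBT) (ht : t.coords.length = n)
    (h : TamariCovAt p r t t') :
    0 < ∑ i : Fin n, (PBT.M n t' i - PBT.M n t i) *
        (((n : ℝ) - ((i : ℕ) : ℝ)) - (((i : ℕ) : ℝ) + 1)) := by
  obtain ⟨l₁, l₂, l₃, x, y, c, hc, h₁, h₂⟩ := h.exists_coords_eq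
  have hn : l₁.length + 1 + l₂.length < n := by
    rw [← ht, h₁]
    simp only [List.length_append, List.length_cons]
    omega
  have key (i : Fin n) : PBT.M n t' i - PBT.M n t i =
      (if i = (⟨l₁.length, by omega⟩ : Fin n) then c else 0) -
        if i = (⟨l₁.length + 1 + l₂.length, hn⟩ : Fin n) then c else 0 := by
    simp only [PBT.M, h₁, h₂, List.getD_sub_getD_of_transfer, Fin.ext_iff]
  simp only [key, sub_mul _ _ (_ - _ : ℝ), ite_mul, zero_mul, Finset.sum_sub_distrib,
    Finset.sum_ite_eq', Finset.mem_univ, if_true]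
  push_cast
  have : 0 < c * (2 * (l₂.length + 1)) := by positivity
  linarith
end
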